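/- Theta graph integral identity: for all real numbers a, b, c > 0, the function r ↦ sin(ar)·sin(br)·sin(cr)/sinh(r) is Lebesgue integrable on (0,∞), and ∫₀^∞ (sin(ar)·sin(br)·sin(cr)/sinh r) dr = (π/8)·( tanh(π(b+c−a)/2) + tanh(π(c+a−b)/2) + tanh(π(a+b−c)/2) − tanh(π(a+b+c)/2) ). -/

import Mathlib

open Real MeasureTheory

/-- The Mittag-Leffler expansion of the hyperbolic cotangent. -/
theorem hasSum_two_mul_div_sq_add_sq {x : ℝ} (hx : x ≠ 0) :
    HasSum (fun n : ℕ => 2 * x / (x ^ 2 + ((n : ℝ) + 1) ^ 2))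
      (π * (cosh (π * x) / sinh (π * x)) - 1 / x) := by
  have hxc : (x : ℂ) ≠ 0 := by exact_mod_cast hx
  have hs : Complex.sinh (π * x) ≠ 0 := by
    rw [← Complex.ofReal_mul, ← Complex.ofReal_sinh]
    exact_mod_cast Real.sinh_ne_zero.2 (mul_ne_zero pi_ne_zero hx)
  have hz : (x * Complex.I : ℂ) ∈ Complex.integerComplement := by
    rintro ⟨n, hn⟩
    apply hx
    simpa using (congrArg Complex.im hn).symm
  have h := (summable_cotTerm hz).hasSum
  rw [← cot_series_rep' hz] at h
  rw [← Complex.hasSum_ofReal]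
  convert! h.mul_left Complex.I using 1
  · ext n
    rw [cotTerm_identity hz]
    have h1 : ((x : ℂ) ^ 2 + ((n : ℂ) + 1) ^ 2) ≠ 0 := by
      have : x ^ 2 + ((n : ℝ) + 1) ^ 2 ≠ 0 := by positivity
      exact_mod_cast this
    have h2 : (x * Complex.I + ((n : ℂ) + 1)) * (x * Complex.I - ((n : ℂ) + 1))
        = -((x : ℂ) ^ 2 + ((n : ℂ) + 1) ^ 2) := by
      linear_combination (x : ℂ) ^ 2 * Complex.I_sq
    rw [h2]
    push_cast
    field_simp
    linear_combination Complex.I_sq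
  · rw [← mul_assoc (π : ℂ), Complex.cot_eq_cos_div_sin, Complex.cos_mul_I, Complex.sin_mul_I]
    push_cast
    field_simp

/-- The partial fraction expansion of the hyperbolic tangent. -/
theorem hasSum_two_mul_div_odd_sq_add_sq (x : ℝ) :
    HasSum (fun n : ℕ => 2 * (x / ((2 * (n : ℝ) + 1) ^ 2 + x ^ 2)))
      (π / 2 * tanh (π * x / 2)) := by
  rcases eq_or_ne x 0 with rfl | hx
  · simp
  let f : ℕ → ℝ := fun n => 2 * x / (x ^ 2 + ((n : ℝ) + 1) ^ 2)
  have h1 : HasSum f _ := hasSum_two_mul_div_sq_add_sq hx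
  have h2 := hasSum_two_mul_div_sq_add_sq (div_ne_zero hx two_ne_zero)
  have hinj : Function.Injective fun n : ℕ => 2 * n := fun a b h => by simpa using h
  have he : HasSum (fun n => f (2 * n)) (∑' n, f (2 * n)) :=
    (h1.summable.comp_injective hinj).hasSum
  have ho : HasSum (fun n => f (2 * n + 1))
      ((π * (cosh (π * (x / 2)) / sinh (π * (x / 2))) - 1 / (x / 2)) / 2) := by
    convert! h2.div_const 2 using 1
    ext n
    simp only [f]
    push_cast
    have : x ^ 2 + (2 * (n : ℝ) + 1 + 1) ^ 2 ≠ 0 := by positivity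
    have : (x / 2) ^ 2 + ((n : ℝ) + 1) ^ 2 ≠ 0 := by positivity
    have : x ^ 2 + 2 ^ 2 * ((n : ℝ) + 1) ^ 2 ≠ 0 := by positivity
    field_simp
    ring
  have hsum := (he.even_add_odd ho).unique h1
  have hval : π / 2 * tanh (π * x / 2) = ∑' n, f (2 * n) := by
    have hs : sinh (π * x / 2) ≠ 0 := Real.sinh_ne_zero.2 (by positivity)
    have hc : cosh (π * x / 2) ≠ 0 := (Real.cosh_pos _).ne'
    rw [eq_sub_of_add_eq hsum, tanh_eq_sinh_div_cosh, show π * (x / 2) = π * x / 2 by ring]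
    have hy : π * x = 2 * (π * x / 2) := by ring
    rw [show cosh (π * x) = _ from congrArg cosh hy, show sinh (π * x) = _ from congrArg sinh hy,
      Real.sinh_two_mul, Real.cosh_two_mul]
    field_simp
    ring
  rw [hval]
  convert! he using 1
  ext n
  simp only [f]
  push_cast
  ring

theorem sin_mul_exp_eq_im (x c r : ℝ) :
    sin (x * r) * exp (-(c * r)) = (Complex.exp ((-c + x * Complex.I) * r)).im := by
  rw [Complex.exp_im]
  simp [mul_comm]

theorem integrableOn_sin_mul_exp (x : ℝ) {c : ℝ} (hc : 0 < c) :
    IntegrableOn (fun r => sin (x * r) * exp (-(c * r))) (Set.Ioi 0) := by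
  simp_rw [sin_mul_exp_eq_im]
  exact (integrableOn_exp_mul_complex_Ioi (a := -c + x * Complex.I) (by simpa using hc) 0).im

/-- The Laplace transform of the sine function. -/
theorem integral_sin_mul_exp (x : ℝ) {c : ℝ} (hc : 0 < c) :
    ∫ r in Set.Ioi (0 : ℝ), sin (x * r) * exp (-(c * r)) = x / (c ^ 2 + x ^ 2) := by
  have ha : ((-c : ℂ) + x * Complex.I).re < 0 := by simpa using hc
  simp_rw [sin_mul_exp_eq_im]
  refine (integral_im (integrableOn_exp_mul_complex_Ioi ha 0)).trans ?_
  rw [integral_exp_mul_complex_Ioi ha]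
  simp [Complex.normSq_apply, sq, neg_div]

theorem integral_norm_sin_mul_exp_le (x : ℝ) {c : ℝ} (hc : 0 < c) :
    ∫ r in Set.Ioi (0 : ℝ), ‖sin (x * r) * exp (-(c * r))‖ ≤ |x| * (1 / c ^ 2) := by
  have h := integral_rpow_mul_exp_neg_mul_Ioi two_pos hc
  norm_num at h
  have hi : IntegrableOn (fun r : ℝ => r * exp (-(c * r))) (Set.Ioi 0) :=
    .of_integral_ne_zero (by rw [h]; positivity)
  rw [one_div, ← h, ← integral_const_mul]
  refine setIntegral_mono_on (integrableOn_sin_mul_exp x hc).norm (hi.const_mul _)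
    measurableSet_Ioi fun r hr => ?_
  rw [norm_mul, norm_eq_abs, norm_eq_abs, abs_exp, ← mul_assoc]
  gcongr
  exact abs_sin_le_abs.trans_eq (by rw [abs_mul, abs_of_pos (Set.mem_Ioi.1 hr)])

theorem hasSum_two_mul_exp_neg_odd {r : ℝ} (hr : 0 < r) :
    HasSum (fun n : ℕ => 2 * exp (-((2 * (n : ℝ) + 1) * r))) (1 / sinh r) := by
  have hlt : exp (-(2 * r)) < 1 := by
    rw [exp_lt_one_iff]
    linarith
  convert! (hasSum_geometric_of_lt_one (exp_pos _).le hlt).mul_left (2 * exp (-r)) using 1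
  · ext n
    rw [← exp_nat_mul, mul_assoc, ← exp_add]
    ring_nf
  · have h1 : sinh r ≠ 0 := (sinh_pos_iff.2 hr).ne'
    have h2 : 1 - exp (-(2 * r)) ≠ 0 := (sub_pos.2 hlt).ne'
    rw [eq_mul_inv_iff_mul_eq₀ h2, one_div, inv_mul_eq_iff_eq_mul₀ h1, sinh_eq]
    have h3 : exp (-(2 * r)) = exp (-r) * exp (-r) := by rw [← exp_add]; ring_nf
    have h4 : exp r * exp (-r) = 1 := by rw [← exp_add]; simp
    rw [h3]
    linear_combination -h4

/-- The Fourier sine transform of `1 / sinh`. -/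
theorem integral_sin_mul_div_sinh (x : ℝ) :
    ∫ r in Set.Ioi (0 : ℝ), sin (x * r) / sinh r = π / 2 * tanh (π * x / 2) := by
  have hpos (n : ℕ) : 0 < 2 * (n : ℝ) + 1 := by positivity
  have key := hasSum_integral_of_summable_integral_norm (μ := volume.restrict (Set.Ioi (0 : ℝ)))
    (F := fun (n : ℕ) r => 2 * (sin (x * r) * exp (-((2 * (n : ℝ) + 1) * r))))
    (fun n => (integrableOn_sin_mul_exp x (hpos n)).const_mul 2) ?_
  · simp_rw [integral_const_mul, integral_sin_mul_exp x (hpos _)] at key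
    rw [← key.unique (hasSum_two_mul_div_odd_sq_add_sq x)]
    refine setIntegral_congr_fun measurableSet_Ioi fun r hr => ?_
    simp_rw [mul_left_comm (2 : ℝ)]
    rw [((hasSum_two_mul_exp_neg_odd hr).mul_left (sin (x * r))).tsum_eq, mul_one_div]
  · have hsq : Summable fun n : ℕ => 1 / (2 * (n : ℝ) + 1) ^ 2 := by
      have hinj : Function.Injective fun n : ℕ => 2 * n + 1 := fun a b h => by simpa using h
      convert! (summable_one_div_nat_pow.2 one_lt_two).comp_injective hinj using 1
      ext n
      simp
    refine .of_nonneg_of_le (fun n => by positivity) (fun n => ?_)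
      ((hsq.mul_left |x|).mul_left 2)
    simp_rw [norm_mul (2 : ℝ), integral_const_mul, norm_ofNat]
    gcongr
    exact integral_norm_sin_mul_exp_le x (hpos n)

theorem integrableOn_sin_mul_div_sinh (x : ℝ) :
    IntegrableOn (fun r => sin (x * r) / sinh r) (Set.Ioi 0) := by
  rcases eq_or_ne x 0 with rfl | hx
  · simp
  refine .of_integral_ne_zero ?_
  rw [integral_sin_mul_div_sinh, tanh_eq_sinh_div_cosh]
  have hs : sinh (π * x / 2) ≠ 0 := Real.sinh_ne_zero.2 (by positivity)
  have hc : cosh (π * x / 2) ≠ 0 := (Real.cosh_pos _).ne'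
  positivity

theorem sin_mul_sin_mul_sin (x y z : ℝ) :
    sin x * sin y * sin z =
      1 / 4 * (sin (y + z - x) + sin (z + x - y) + sin (x + y - z) - sin (x + y + z)) := by
  simp only [sin_sub, sin_add, cos_add]
  ring

/-- Theta graph integral identity: for `a, b, c > 0`, the function
`r ↦ sin(ar) sin(br) sin(cr) / sinh r` is integrable on `(0,∞)` and
`∫₀^∞ sin(ar) sin(br) sin(cr)/sinh r dr = (π/8)(tanh(π(b+c−a)/2) + tanh(π(c+a−b)/2)
+ tanh(π(a+b−c)/2) − tanh(π(a+b+c)/2))`. -/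
theorem theta_integral (a b c : ℝ) (ha : 0 < a) (hb : 0 < b) (hc : 0 < c) :
    IntegrableOn
      (fun r => Real.sin (a * r) * Real.sin (b * r) * Real.sin (c * r) / Real.sinh r)
      (Set.Ioi 0)
    ∧ (∫ r in Set.Ioi (0 : ℝ),
          Real.sin (a * r) * Real.sin (b * r) * Real.sin (c * r) / Real.sinh r)
        = (π / 8) * (Real.tanh (π * (b + c - a) / 2) + Real.tanh (π * (c + a - b) / 2)
            + Real.tanh (π * (a + b - c) / 2) - Real.tanh (π * (a + b + c) / 2)) := by
  have heq : (fun r => sin (a * r) * sin (b * r) * sin (c * r) / sinh r) = fun r =>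
      1 / 4 * (sin ((b + c - a) * r) / sinh r + sin ((c + a - b) * r) / sinh r
        + sin ((a + b - c) * r) / sinh r - sin ((a + b + c) * r) / sinh r) := by
    ext r
    rw [sin_mul_sin_mul_sin]
    ring_nf
  have h1 := integrableOn_sin_mul_div_sinh (b + c - a)
  have h2 := integrableOn_sin_mul_div_sinh (c + a - b)
  have h3 := integrableOn_sin_mul_div_sinh (a + b - c)
  have h4 := integrableOn_sin_mul_div_sinh (a + b + c)
  rw [heq]
  have h12 : IntegrableOn
      (fun r => sin ((b + c - a) * r) / sinh r + sin ((c + a - b) * r) / sinh r) (Set.Ioi 0) :=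
    h1.add h2
  have h123 : IntegrableOn (fun r => sin ((b + c - a) * r) / sinh r
      + sin ((c + a - b) * r) / sinh r + sin ((a + b - c) * r) / sinh r) (Set.Ioi 0) :=
    h12.add h3
  refine ⟨(h123.sub h4).const_mul _, ?_⟩
  rw [integral_const_mul, integral_sub h123 h4, integral_add h12 h3, integral_add h1 h2]
  simp only [integral_sin_mul_div_sinh]
  ring
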